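/- Let T be a tree with at least 3 edges and no internal vertex of degree 2, and let n₀ = |{u internal : deg(u) = 3}|, d = ∑_{u internal} deg(u). Then the number of facets of P_T equals (|E| − e₃) + d, where e₃ is the number of edges having at least one endpoint of degree 3; equivalently, the minimal H-representation of P_T consists of exactly (|E| − e₃) + d inequalities together with one equation. -/

import Mathlib

open Classical SimpleGraph

noncomputable section

variable {V : Type*}

/-- A leaf: a vertex with exactly one neighbor. -/
def IsLeaf (G : SimpleGraph V) (v : V) : Prop := ∃! w, G.Adj v w

/-- `e` is an edge on the (unique, for trees) path between `i` and `j`. -/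
def onPath (G : SimpleGraph V) (i j : V) (e : Sym2 V) : Prop :=
  ∃ p : G.Walk i j, p.IsPath ∧ e ∈ p.edges

/-- The edge indicator vector `c^{i↔j}` of the path between `i` and `j`. -/
def pathVec (G : SimpleGraph V) (i j : V) : Sym2 V → ℝ :=
  fun e => if onPath G i j e then 1 else 0

/-- The path polytope `P_T`: the convex hull of the indicator vectors of the
paths between pairs of distinct leaves. -/
def pathPolytope (G : SimpleGraph V) : Set (Sym2 V → ℝ) :=
  convexHull ℝ {x | ∃ i j : V, i ≠ j ∧ IsLeaf G i ∧ IsLeaf G j ∧ x = pathVec G i j}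

/-- `E_leaf(T)`: edges incident to at least one leaf. -/
def leafEdges (G : SimpleGraph V) : Set (Sym2 V) :=
  {e | e ∈ G.edgeSet ∧ ∃ v ∈ e, IsLeaf G v}

/-- A face of `P`: the intersection of `P` with the boundary hyperplane of a valid
linear inequality. -/
def IsFaceOf {E : Type*} [AddCommGroup E] [Module ℝ E] (P F : Set E) : Prop :=
  ∃ (a : E →ₗ[ℝ] ℝ) (b : ℝ), (∀ x ∈ P, a x ≤ b) ∧ F = {x ∈ P | a x = b}

/-- The dimension of a polytope: the rank of the direction of its affine span. -/
def polyDim {E : Type*} [AddCommGroup E] [Module ℝ E] (P : Set E) : ℕ :=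
  Module.finrank ℝ (affineSpan ℝ P).direction

/-- A facet: a face of dimension `dim P − 1`. -/
def IsFacetOf {E : Type*} [AddCommGroup E] [Module ℝ E] (P F : Set E) : Prop :=
  IsFaceOf P F ∧ polyDim F + 1 = polyDim P
section TreePart
variable {G : SimpleGraph V}

lemma pv_of_path (hG : G.IsTree) {i j : V} (p : G.Walk i j) (hp : p.IsPath) (e : Sym2 V) :
    pathVec G i j e = if e ∈ p.edges then 1 else 0 := by
  have : onPath G i j e ↔ e ∈ p.edges := by
    constructor
    · rintro ⟨q, hq, he⟩
      rwa [(hG.existsUnique_path i j).unique hp hq]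
    · exact fun h => ⟨p, hp, h⟩
  simp [pathVec, this]

lemma pv_self (hG : G.IsTree) (i : V) : pathVec G i i = 0 := by
  funext e
  rw [pv_of_path hG (Walk.nil : G.Walk i i) (by simp)]
  simp

lemma pv_comm (hG : G.IsTree) (i j : V) : pathVec G i j = pathVec G j i := by
  funext e
  obtain ⟨p, hp, -⟩ := hG.existsUnique_path i j
  rw [pv_of_path hG p hp, pv_of_path hG p.reverse hp.reverse]
  simp

lemma pv_01 (i j : V) (e : Sym2 V) : pathVec G i j e = 0 ∨ pathVec G i j e = 1 := by
  unfold pathVec; split_ifs <;> simp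

lemma pv_nonneg (i j : V) (e : Sym2 V) : 0 ≤ pathVec G i j e := by
  rcases pv_01 (G := G) i j e with h | h <;> rw [h]; norm_num

lemma pv_notEdge (i j : V) (e : Sym2 V) (he : e ∉ G.edgeSet) : pathVec G i j e = 0 := by
  unfold pathVec
  rw [if_neg]
  rintro ⟨p, -, h⟩
  exact he (p.edges_subset_edgeSet h)

lemma pv_split (hG : G.IsTree) {i u j : V} (p : G.Walk i u) (q : G.Walk u j)
    (h : (p.append q).IsPath) : pathVec G i j = pathVec G i u + pathVec G u j := by
  funext e
  rw [Pi.add_apply, pv_of_path hG _ h, pv_of_path hG p h.of_append_left,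
    pv_of_path hG q h.of_append_right]
  have hn := h.isTrail.edges_nodup
  rw [Walk.edges_append, List.nodup_append] at hn
  rw [Walk.edges_append]
  by_cases h1 : e ∈ p.edges <;> by_cases h2 : e ∈ q.edges <;> simp [h1, h2]
  exact (hn.2.2 e h1 e h2 rfl).elim

lemma pv_K1 (hG : G.IsTree) {i j u w : V} (h : pathVec G i j s(u,w) ≠ 0) :
    pathVec G i j = pathVec G i u + pathVec G u j := by
  obtain ⟨p, hp, -⟩ := hG.existsUnique_path i j
  rw [pv_of_path hG p hp] at h
  have he : s(u,w) ∈ p.edges := by by_contra h'; simp [h'] at h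
  have hu : u ∈ p.support := Walk.fst_mem_support_of_mem_edges p he
  apply pv_split hG (p.takeUntil u hu) (p.dropUntil u hu)
  rwa [Walk.take_spec]

lemma path_first (hG : G.IsTree) {u j n : V} (h : G.Adj u n) (q : G.Walk n j)
    (hp : (Walk.cons h q).IsPath) (w : V) :
    pathVec G u j s(u,w) = if w = n then 1 else 0 := by
  rw [pv_of_path hG _ hp]
  have : s(u,w) ∈ (Walk.cons h q).edges ↔ w = n := by
    rw [Walk.edges_cons, List.mem_cons]
    constructor
    · rintro (h1 | h1)
      · exact Sym2.congr_right.1 h1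
      · exact ((Walk.cons_isPath_iff _ _).1 hp).2 (Walk.fst_mem_support_of_mem_edges q h1) |>.elim
    · rintro rfl; simp
  simp only [this]

lemma exists_nxt (hG : G.IsTree) {u j : V} (huj : u ≠ j) :
    ∃ n, G.Adj u n ∧ ∀ w, pathVec G u j s(u,w) = if w = n then 1 else 0 := by
  obtain ⟨p, hp, -⟩ := hG.existsUnique_path u j
  cases p with
  | nil => exact (huj rfl).elim
  | cons h q => exact ⟨_, h, path_first hG h q hp⟩

/-- next vertex from `u` towards `j` -/
def nxt (G : SimpleGraph V) (u j : V) : V :=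
  if h : ∃ n, G.Adj u n ∧ ∀ w, pathVec G u j s(u,w) = if w = n then 1 else 0 then h.choose else u

lemma nxt_adj (hG : G.IsTree) {u j : V} (huj : u ≠ j) : G.Adj u (nxt G u j) := by
  have h := exists_nxt hG huj
  rw [nxt, dif_pos h]; exact h.choose_spec.1

lemma nxt_spec (hG : G.IsTree) {u j : V} (huj : u ≠ j) (w : V) :
    pathVec G u j s(u,w) = if w = nxt G u j then 1 else 0 := by
  have h := exists_nxt hG huj
  rw [nxt, dif_pos h]; exact h.choose_spec.2 w

lemma nxt_eq (hG : G.IsTree) {u j n : V} (huj : u ≠ j) (h : pathVec G u j s(u,n) ≠ 0) :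
    nxt G u j = n := by
  rw [nxt_spec hG huj] at h
  by_contra h'
  rw [if_neg (Ne.symm h')] at h
  exact h rfl

lemma pv_adj (hG : G.IsTree) {u w : V} (h : G.Adj u w) :
    pathVec G u w = Pi.single s(u,w) 1 := by
  funext e
  rw [pv_of_path hG (Walk.cons h Walk.nil) (by simp [h.ne])]
  simp [Pi.single_apply]

lemma nxt_of_adj (hG : G.IsTree) {u w : V} (h : G.Adj u w) : nxt G u w = w := by
  apply nxt_eq hG h.ne
  rw [pv_adj hG h]; simp

lemma pv_K2 (hG : G.IsTree) {u i j : V} (hi : u ≠ i) (hj : u ≠ j)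
    (h : nxt G u i ≠ nxt G u j) : pathVec G i j = pathVec G i u + pathVec G u j := by
  obtain ⟨p, hp, -⟩ := hG.existsUnique_path u i
  obtain ⟨q, hq, -⟩ := hG.existsUnique_path u j
  apply pv_split hG p.reverse q
  rw [hG.isAcyclic.isPath_iff_isChain, Walk.edges_append, List.isChain_append]
  refine ⟨(hG.isAcyclic.isPath_iff_isChain _).1 hp.reverse,
    (hG.isAcyclic.isPath_iff_isChain _).1 hq, ?_⟩
  cases p with
  | nil => exact (hi rfl).elim
  | @cons _ a _ ha p' =>
  cases q with
  | nil => exact (hj rfl).elim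
  | @cons _ b _ hb q' =>
  have h1 : nxt G u i = a := nxt_eq hG hi (by rw [path_first hG ha p' hp]; simp)
  have h2 : nxt G u j = b := nxt_eq hG hj (by rw [path_first hG hb q' hq]; simp)
  rw [h1, h2] at h
  intro x hx y hy
  simp at hx hy
  subst hx hy
  intro h'
  rw [Sym2.eq_swap] at h'
  exact h (Sym2.congr_right.1 h')

/-- if `u` is strictly inside the path, next vertices differ. -/
lemma nxt_ne (hG : G.IsTree) {u i j : V} (hi : u ≠ i) (hj : u ≠ j)
    (h : pathVec G i j = pathVec G i u + pathVec G u j) : nxt G u i ≠ nxt G u j := by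
  intro he
  have h1 := congrFun h s(u, nxt G u i)
  rw [Pi.add_apply, pv_comm hG i u, nxt_spec hG hi, nxt_spec hG hj, if_pos rfl, if_pos he] at h1
  rcases pv_01 (G := G) i j s(u, nxt G u i) with h2 | h2 <;> rw [h2] at h1 <;> norm_num at h1

/-- extension of a path by an edge -/
lemma pv_extend (hG : G.IsTree) {i j c : V} (hij : i ≠ j) (hc : G.Adj j c) (hne : c ≠ nxt G j i) :
    pathVec G i c = pathVec G i j + Pi.single s(j,c) 1 := by
  rw [pv_K2 hG hij.symm hc.ne (by rw [nxt_of_adj hG hc]; exact hne.symm), pv_adj hG hc]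

lemma pv_extend_ne (hG : G.IsTree) {i j c : V} (_hij : i ≠ j) (hc : G.Adj j c)
    (hne : c ≠ nxt G j i) : i ≠ c := by
  rintro rfl
  exact hne (nxt_of_adj hG hc).symm

lemma nxt_extend (hG : G.IsTree) {i j c : V} (hij : i ≠ j) (hc : G.Adj j c)
    (hne : c ≠ nxt G j i) : nxt G i c = nxt G i j := by
  apply nxt_eq hG (pv_extend_ne hG hij hc hne)
  rw [pv_extend hG hij hc hne, Pi.add_apply, nxt_spec hG hij, if_pos rfl, Pi.single_apply]
  split_ifs <;> norm_num

/-- first-step decomposition -/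
lemma pv_first (hG : G.IsTree) {i j w : V} (hij : i ≠ j) (hw : nxt G i j = w) :
    pathVec G i j = Pi.single s(i,w) 1 + pathVec G w j := by
  have ha := nxt_adj hG hij
  rw [hw] at ha
  rw [pv_K1 hG (i := i) (j := j) (u := w) (w := i), pv_adj hG ha]
  rw [Sym2.eq_swap, nxt_spec hG hij, hw]; simp

variable [Fintype V]

lemma extend_leaf (hG : G.IsTree) (Good : V → V → Prop)
    (hstep : ∀ i j, i ≠ j → Good i j → ¬ IsLeaf G j →
      ∃ c, G.Adj j c ∧ c ≠ nxt G j i ∧ Good i c)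
    {i j : V} (hij : i ≠ j) (h : Good i j) :
    ∃ l, IsLeaf G l ∧ i ≠ l ∧ Good i l ∧ nxt G i l = nxt G i j := by
  obtain ⟨l, hl, hmax⟩ := Set.exists_max_image {l | i ≠ l ∧ Good i l ∧ nxt G i l = nxt G i j}
    (fun l => ∑ e, pathVec G i l e) (Set.toFinite _) ⟨j, hij, h, rfl⟩
  refine ⟨l, ?_, hl⟩
  by_contra hnl
  obtain ⟨c, hc, hne, hgood⟩ := hstep i l hl.1 hl.2.1 hnl
  have := hmax c ⟨pv_extend_ne hG hl.1 hc hne, hgood, by rw [nxt_extend hG hl.1 hc hne, hl.2.2]⟩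
  rw [pv_extend hG hl.1 hc hne] at this
  simp [Finset.sum_add_distrib] at this
  linarith

end TreePart
section AbstractPart
variable {E : Type*} [AddCommGroup E] [Module ℝ E]

lemma cone_nonneg {J : Type*} [Fintype J] (m : J → E →ₗ[ℝ] ℝ) (c : E →ₗ[ℝ] ℝ) (W : Submodule ℝ E)
    (hstep : ∀ x ∈ W, (∀ j, 0 ≤ m j x) → x ≠ 0 → ∃ p ∈ W, 0 ≤ c p ∧ (∀ j, 0 ≤ m j p) ∧
      (∃ j, 0 < m j p) ∧ ∀ j, m j x = 0 → m j p = 0) :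
    ∀ x ∈ W, (∀ j, 0 ≤ m j x) → 0 ≤ c x := by
  suffices H : ∀ n : ℕ, ∀ x ∈ W, (∀ j, 0 ≤ m j x) →
      (Finset.univ.filter (fun j => m j x ≠ 0)).card = n → 0 ≤ c x from
    fun x hx h => H _ x hx h rfl
  intro n
  induction n using Nat.strong_induction_on with
  | _ n ih =>
  intro x hx h hn
  by_cases hx0 : x = 0
  · simp [hx0]
  obtain ⟨p, hpW, hcp, hp, ⟨j0, hj0⟩, ht⟩ := hstep x hx h hx0
  obtain ⟨j1, hj1, hmin⟩ := Finset.exists_min_image (Finset.univ.filter (fun j => 0 < m j p))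
    (fun j => m j x / m j p) ⟨j0, by simpa using hj0⟩
  have hj1 : 0 < m j1 p := by simpa using hj1
  set ε := m j1 x / m j1 p with hε
  have hε0 : 0 ≤ ε := div_nonneg (h _) hj1.le
  have hy : ∀ j, m j (x - ε • p) = m j x - ε * m j p := by intro j; simp
  have hy0 : ∀ j, 0 ≤ m j (x - ε • p) := by
    intro j
    rw [hy]
    rcases (hp j).eq_or_lt with h1 | h1
    · rw [← h1]; simpa using h j
    · have := hmin j (by simpa using h1)
      rw [le_div_iff₀ h1] at this
      linarith
  have hlt : (Finset.univ.filter (fun j => m j (x - ε • p) ≠ 0)).card < n := by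
    rw [← hn]
    apply Finset.card_lt_card
    rw [Finset.ssubset_iff_of_subset]
    · refine ⟨j1, ?_, ?_⟩
      · simp only [Finset.mem_filter, Finset.mem_univ, true_and]
        intro h0
        rw [ht _ h0] at hj1
        exact lt_irrefl _ hj1
      · simp only [Finset.mem_filter, Finset.mem_univ, true_and, not_not]
        rw [hy, hε, div_mul_cancel₀ _ hj1.ne', sub_self]
    · intro j
      simp only [Finset.mem_filter, Finset.mem_univ, true_and]
      intro h1 h2
      apply h1
      rw [hy, h2, ht j h2]; simp
  have := ih _ hlt (x - ε • p) (W.sub_mem hx (W.smul_mem _ hpW)) hy0 rfl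
  rw [map_sub, map_smul, smul_eq_mul] at this
  nlinarith [mul_nonneg hε0 hcp]

lemma interior_zero {J : Type*} [Fintype J] (m : J → E →ₗ[ℝ] ℝ) (c : E →ₗ[ℝ] ℝ) (W : Submodule ℝ E)
    (hc : ∀ x ∈ W, (∀ j, 0 ≤ m j x) → 0 ≤ c x) (x : E) (hx : x ∈ W) (hcx : c x = 0)
    (hpos : ∀ j, 0 < m j x ∨ ∀ d ∈ W, m j d = 0) : ∀ d ∈ W, c d = 0 := by
  have key : ∀ d ∈ W, 0 ≤ c d := by
    intro d hd
    have h1 : ∀ᶠ ε in nhdsWithin (0:ℝ) (Set.Ioi 0), ∀ j, 0 ≤ m j (x + ε • d) := by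
      rw [Filter.eventually_all]
      intro j
      rcases hpos j with h | h
      · have h2 : Filter.Tendsto (fun ε : ℝ => m j x + ε * m j d) (nhdsWithin (0:ℝ) (Set.Ioi 0))
            (nhds (m j x + 0 * m j d)) := by
          apply Filter.Tendsto.mono_left _ nhdsWithin_le_nhds
          apply Continuous.tendsto
          fun_prop
        have h3 := h2.eventually (lt_mem_nhds (a := 0) (by simpa using h))
        filter_upwards [h3] with ε hε
        simpa using hε.le
      · filter_upwards with ε
        rw [h _ (W.add_mem hx (W.smul_mem _ hd))]
    obtain ⟨ε, h2, h3⟩ := (h1.and self_mem_nhdsWithin).exists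
    have := hc _ (W.add_mem hx (W.smul_mem ε hd)) h2
    rw [map_add, map_smul, hcx, zero_add, smul_eq_mul] at this
    exact nonneg_of_mul_nonneg_right this h3
  intro d hd
  have := key (-d) (W.neg_mem hd)
  rw [map_neg] at this
  linarith [key d hd]

variable [FiniteDimensional ℝ E]

lemma polyDim_add_one (F : Set E) (L : E →ₗ[ℝ] ℝ) (hL : ∀ x ∈ F, L x = 2) (hF : F.Nonempty) :
    polyDim F + 1 = Module.finrank ℝ (Submodule.span ℝ F) := by
  obtain ⟨x, hx⟩ := hF
  unfold polyDim
  rw [direction_affineSpan]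
  have hker : vectorSpan ℝ F ≤ LinearMap.ker L := by
    rw [vectorSpan, Submodule.span_le]
    rintro _ ⟨a, ha, b, hb, rfl⟩
    simp [hL a ha, hL b hb]
  have hxn : x ∉ vectorSpan ℝ F := by
    intro h
    have := hker h
    rw [LinearMap.mem_ker, hL x hx] at this
    norm_num at this
  have hspan : Submodule.span ℝ F = vectorSpan ℝ F ⊔ Submodule.span ℝ {x} := by
    apply le_antisymm
    · rw [Submodule.span_le]
      intro y hy
      have h1 : y -ᵥ x ∈ vectorSpan ℝ F := vsub_mem_vectorSpan ℝ hy hx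
      have : y = (y -ᵥ x) + x := by simp
      rw [this]
      exact Submodule.add_mem_sup h1 (Submodule.mem_span_singleton_self x)
    · apply sup_le
      · rw [vectorSpan, Submodule.span_le]
        rintro _ ⟨a, ha, b, hb, rfl⟩
        exact Submodule.sub_mem _ (Submodule.subset_span ha) (Submodule.subset_span hb)
      · rw [Submodule.span_singleton_le_iff_mem]
        exact Submodule.subset_span hx
  have hdisj : vectorSpan ℝ F ⊓ Submodule.span ℝ {x} = ⊥ := by
    rw [← disjoint_iff]
    exact Submodule.disjoint_span_singleton_of_notMem hxn
  have := Submodule.finrank_sup_add_finrank_inf_eq (vectorSpan ℝ F) (Submodule.span ℝ {x})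
  rw [hdisj, ← hspan, finrank_bot, finrank_span_singleton] at this
  · omega
  · rintro rfl; simpa using hL _ hx

lemma facets_eq {I : Type*} (P : Set E) (L : E →ₗ[ℝ] ℝ) (hL : ∀ x ∈ P, L x = 2)
    (l : I → E →ₗ[ℝ] ℝ) (hl : ∀ i, ∀ x ∈ P, 0 ≤ l i x)
    (h1 : ∀ c : E →ₗ[ℝ] ℝ, (∀ x ∈ P, 0 ≤ c x) → (∀ x ∈ P, c x = 0) ∨
      ∃ i, ∀ x ∈ P, c x = 0 → l i x = 0)
    (h2 : ∀ i, ∀ f : E →ₗ[ℝ] ℝ, (∀ x ∈ P, l i x = 0 → f x = 0) → ∃ t : ℝ, ∀ x ∈ P, f x = t * l i x)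
    (h3 : ∀ i, ∃ x ∈ P, l i x ≠ 0)
    (h4 : 3 ≤ Module.finrank ℝ (Submodule.span ℝ P)) :
    {F : Set E | IsFacetOf P F} = Set.range (fun i => {x ∈ P | l i x = 0}) := by
  have hPne : P.Nonempty := by
    by_contra h
    rw [Set.not_nonempty_iff_eq_empty] at h
    subst h
    rw [Submodule.span_empty, finrank_bot] at h4
    omega
  have hPd := polyDim_add_one P L hL hPne
  have hrank : ∀ i, Module.finrank ℝ (Submodule.span ℝ {x ∈ P | l i x = 0}) + 1
      = Module.finrank ℝ (Submodule.span ℝ P) := by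
    intro i
    obtain ⟨x, hx, hlx⟩ := h3 i
    set S := Submodule.span ℝ {x ∈ P | l i x = 0} with hS
    have hSk : S ≤ LinearMap.ker (l i) := by
      rw [hS, Submodule.span_le]
      rintro y ⟨-, hy⟩
      exact hy
    have hxS : x ∉ S := fun h => hlx (hSk h)
    have hle : S ⊔ Submodule.span ℝ {x} ≤ Submodule.span ℝ P := by
      apply sup_le
      · exact Submodule.span_mono (fun y hy => hy.1)
      · rw [Submodule.span_singleton_le_iff_mem]
        exact Submodule.subset_span hx
    have hspan : Submodule.span ℝ P = S ⊔ Submodule.span ℝ {x} := by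
      apply le_antisymm _ hle
      rw [Submodule.span_le]
      intro y hy
      by_contra hyn
      obtain ⟨f, hf, hfk⟩ := Submodule.exists_le_ker_of_notMem hyn
      obtain ⟨t, ht⟩ := h2 i f (fun z hz hz0 => hfk
        (Submodule.mem_sup_left (Submodule.subset_span ⟨hz, hz0⟩)))
      have hfx : f x = 0 := hfk (Submodule.mem_sup_right (Submodule.mem_span_singleton_self x))
      rw [ht x hx] at hfx
      have ht0 : t = 0 := by
        rcases mul_eq_zero.1 hfx with h | h
        · exact h
        · exact (hlx h).elim
      apply hf
      rw [ht y hy, ht0, zero_mul]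
    have hdisj : S ⊓ Submodule.span ℝ {x} = ⊥ := by
      rw [← disjoint_iff]
      exact Submodule.disjoint_span_singleton_of_notMem hxS
    have := Submodule.finrank_sup_add_finrank_inf_eq S (Submodule.span ℝ {x})
    rw [hdisj, ← hspan, finrank_bot, finrank_span_singleton] at this
    · omega
    · rintro rfl; exact hlx (map_zero _)
  have hne : ∀ i, {x ∈ P | l i x = 0}.Nonempty := by
    intro i
    by_contra h
    rw [Set.not_nonempty_iff_eq_empty] at h
    have := hrank i
    rw [h] at this
    rw [Submodule.span_empty, finrank_bot] at this
    omega
  have hFd : ∀ i, polyDim {x ∈ P | l i x = 0} + 1 = polyDim P := by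
    intro i
    have := polyDim_add_one {x ∈ P | l i x = 0} L (fun x hx => hL x hx.1) (hne i)
    have := hrank i
    omega
  ext F
  constructor
  · rintro ⟨⟨a, b, hab, rfl⟩, hdim⟩
    have hc : ∀ x ∈ P, ((b/2) • L - a) x = b - a x := by
      intro x hx
      simp [hL x hx]
    have hFne : {x ∈ P | a x = b}.Nonempty := by
      by_contra h
      rw [Set.not_nonempty_iff_eq_empty] at h
      rw [h] at hdim
      have : polyDim (∅ : Set E) = 0 := by
        unfold polyDim; simp
      omega
    rcases h1 ((b/2) • L - a) (fun x hx => by rw [hc x hx]; linarith [hab x hx]) with h | ⟨i, hi⟩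
    · exfalso
      have : {x ∈ P | a x = b} = P := by
        ext x
        constructor
        · exact fun h => h.1
        · intro hx
          refine ⟨hx, ?_⟩
          have := h x hx
          rw [hc x hx] at this
          linarith
      rw [this] at hdim
      omega
    · refine ⟨i, ?_⟩
      have hsub : {x ∈ P | a x = b} ⊆ {x ∈ P | l i x = 0} := by
        rintro x ⟨hx, hxb⟩
        exact ⟨hx, hi x hx (by rw [hc x hx, hxb, sub_self])⟩
      have hd := polyDim_add_one {x ∈ P | a x = b} L (fun x hx => hL x hx.1) hFne
      have hspan := Submodule.eq_of_le_of_finrank_eq (Submodule.span_mono (R := ℝ) hsub)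
        (by have := hrank i; omega)
      apply Set.Subset.antisymm _ hsub
      intro x hx
      refine ⟨hx.1, ?_⟩
      have hxs : x ∈ Submodule.span ℝ {x ∈ P | a x = b} := by
        rw [hspan]; exact Submodule.subset_span hx
      have hk : Submodule.span ℝ {x ∈ P | a x = b} ≤ LinearMap.ker ((b/2) • L - a) := by
        rw [Submodule.span_le]
        rintro y ⟨hy, hyb⟩
        show ((b/2) • L - a) y = 0
        rw [hc y hy, hyb, sub_self]
      have := hk hxs
      rw [LinearMap.mem_ker, hc x hx.1] at this
      linarith
  · rintro ⟨i, rfl⟩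
    refine ⟨⟨-(l i), 0, ?_, ?_⟩, hFd i⟩
    · intro x hx
      simpa using hl i x hx
    · ext x; simp

end AbstractPart
section Comb
variable [Fintype V] {G : SimpleGraph V}

/-- the functional of the facets `G_T^{(u,v)}` -/
def lf (u v : V) : (Sym2 V → ℝ) →ₗ[ℝ] ℝ :=
  (∑ w : V, LinearMap.proj s(u,w)) - (2:ℝ) • LinearMap.proj s(u,v)

lemma lf_apply (u v : V) (x : Sym2 V → ℝ) : lf u v x = ∑ w, x s(u,w) - 2 * x s(u,v) := by
  simp [lf]

lemma lf_end (hG : G.IsTree) {u j : V} (huj : u ≠ j) (v : V) :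
    lf u v (pathVec G u j) = 1 - 2 * (if v = nxt G u j then 1 else 0) := by
  rw [lf_apply]
  simp_rw [nxt_spec hG huj]
  simp

lemma lf_single (u v w : V) : lf u v (Pi.single s(u,w) 1) = 1 - 2 * (if v = w then 1 else 0) := by
  rw [lf_apply]
  simp_rw [Pi.single_apply, Sym2.congr_right]
  simp

lemma lf_single' {u a b : V} (ha : u ≠ a) (hb : u ≠ b) (v : V) :
    lf u v (Pi.single s(a,b) 1) = 0 := by
  rw [lf_apply]
  have : ∀ w, (Pi.single s(a,b) (1:ℝ) : Sym2 V → ℝ) s(u,w) = 0 := by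
    intro w
    rw [Pi.single_apply, if_neg]
    intro h
    rw [Sym2.eq_iff] at h
    rcases h with h | h
    · exact ha h.1
    · exact hb h.1
  simp [this]

lemma mid_cases (hG : G.IsTree) {u i j : V} (hi : u ≠ i) (hj : u ≠ j) :
    (∀ w, pathVec G i j s(u,w) = 0) ∨
    (nxt G u i ≠ nxt G u j ∧ pathVec G i j = pathVec G u i + pathVec G u j) := by
  by_cases h : ∀ w, pathVec G i j s(u,w) = 0
  · exact Or.inl h
  · push Not at h
    obtain ⟨w, hw⟩ := h
    have h1 := pv_K1 hG hw
    refine Or.inr ⟨nxt_ne hG hi hj h1, ?_⟩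
    rw [h1, pv_comm hG i u]

lemma lf_nonneg (hG : G.IsTree) {u i j : V} (hi : u ≠ i) (hj : u ≠ j) (v : V) :
    0 ≤ lf u v (pathVec G i j) := by
  rcases mid_cases hG hi hj with h | ⟨h1, h2⟩
  · rw [lf_apply]; simp [h]
  · rw [h2, map_add, lf_end hG hi, lf_end hG hj]
    split_ifs with h3 h4
    · exact (h1 (h3.symm.trans h4)).elim
    all_goals norm_num

lemma leaf_unique {l a b : V} (h : IsLeaf G l) (ha : G.Adj l a) (hb : G.Adj l b) : a = b :=
  h.unique ha hb

lemma leaf_sum (hG : G.IsTree) {i j v : V} (hij : i ≠ j) (hv : IsLeaf G v) :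
    ∑ w, pathVec G i j s(v,w) = (if v = i then 1 else 0) + (if v = j then 1 else 0) := by
  by_cases hi : v = i
  · subst hi
    simp_rw [nxt_spec hG hij]
    simp [hij]
  by_cases hj : v = j
  · subst hj
    rw [pv_comm hG]
    simp_rw [nxt_spec hG hij.symm]
    simp [hij.symm]
  rcases mid_cases hG hi hj with h | ⟨h1, h2⟩
  · simp [h, hi, hj]
  · exact (h1 (leaf_unique hv (nxt_adj hG hi) (nxt_adj hG hj))).elim

lemma leaf_end (hG : G.IsTree) {z l w : V} (hzl : z ≠ l) (h : nxt G z l = w) (hw : IsLeaf G w) :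
    w = l := by
  by_contra hwl
  have ha := nxt_adj hG hzl
  rw [h] at ha
  have h1 : pathVec G z l = pathVec G z w + pathVec G w l := by
    rw [pv_first hG hzl h, pv_adj hG ha]
  exact nxt_ne hG ha.ne.symm hwl h1
    (leaf_unique hw (nxt_adj hG ha.ne.symm) (nxt_adj hG hwl))

lemma ex_nbr2 {w : V} (h : 3 ≤ (G.neighborSet w).ncard) (a b : V) :
    ∃ c, G.Adj w c ∧ c ≠ a ∧ c ≠ b := by
  have : ({a, b} : Set V).ncard < (G.neighborSet w).ncard :=
    lt_of_le_of_lt (Set.ncard_insert_le _ _) (by rw [Set.ncard_singleton]; omega)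
  obtain ⟨c, hc, hn⟩ := Set.exists_mem_notMem_of_ncard_lt_ncard this
  simp at hn
  exact ⟨c, hc, hn⟩

lemma ex_nbr3 {w : V} (h : 4 ≤ (G.neighborSet w).ncard) (a b d : V) :
    ∃ c, G.Adj w c ∧ c ≠ a ∧ c ≠ b ∧ c ≠ d := by
  have : ({a, b, d} : Set V).ncard < (G.neighborSet w).ncard := by
    have h1 := Set.ncard_insert_le a ({b, d} : Set V)
    have h2 := Set.ncard_insert_le b ({d} : Set V)
    rw [Set.ncard_singleton] at h2
    omega
  obtain ⟨c, hc, hn⟩ := Set.exists_mem_notMem_of_ncard_lt_ncard this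
  simp at hn
  exact ⟨c, hc, hn⟩

lemma leaf_any (hG : G.IsTree) (h3 : ∀ w, ¬ IsLeaf G w → 3 ≤ (G.neighborSet w).ncard)
    {z w : V} (hw : G.Adj z w) : ∃ l, IsLeaf G l ∧ z ≠ l ∧ nxt G z l = w := by
  obtain ⟨l, h1, h2, -, h4⟩ := extend_leaf hG (fun _ _ => True) (by
    intro i j hij _ hj
    obtain ⟨c, hc, h1, -⟩ := ex_nbr2 (h3 j hj) (nxt G j i) (nxt G j i)
    exact ⟨c, hc, h1, trivial⟩) hw.ne trivial
  exact ⟨l, h1, h2, by rw [h4, nxt_of_adj hG hw]⟩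

lemma leaf_F (hG : G.IsTree) (h3 : ∀ w, ¬ IsLeaf G w → 3 ≤ (G.neighborSet w).ncard)
    {z w : V} (hw : G.Adj z w) (e : Sym2 V) (he : s(z,w) ≠ e) :
    ∃ l, IsLeaf G l ∧ z ≠ l ∧ nxt G z l = w ∧ pathVec G z l e = 0 := by
  obtain ⟨l, h1, h2, h5, h4⟩ := extend_leaf hG (fun i j => pathVec G i j e = 0) (by
    intro i j hij h hj
    obtain ⟨c, hc, h1, -⟩ := ex_nbr2 (h3 j hj) (nxt G j i) (nxt G j i)
    by_cases hce : s(j,c) = e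
    · obtain ⟨d, hd, h1, h2⟩ := ex_nbr2 (h3 j hj) (nxt G j i) c
      refine ⟨d, hd, h1, ?_⟩
      rw [pv_extend hG hij hd h1, Pi.add_apply, h, Pi.single_apply, if_neg, add_zero]
      rintro h'
      rw [← hce, Sym2.congr_right] at h'
      exact h2 h'.symm
    · refine ⟨c, hc, h1, ?_⟩
      rw [pv_extend hG hij hc h1, Pi.add_apply, h, Pi.single_apply, if_neg (Ne.symm hce), add_zero])
      hw.ne (by rw [pv_adj hG hw, Pi.single_apply, if_neg he.symm])
  exact ⟨l, h1, h2, by rw [h4, nxt_of_adj hG hw], h5⟩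

lemma leaf_G (hG : G.IsTree) (h3 : ∀ w, ¬ IsLeaf G w → 3 ≤ (G.neighborSet w).ncard)
    {u v : V} (hu : ¬ IsLeaf G u) (hv : G.Adj u v)
    {z w : V} (hz : u ≠ z) (hw : G.Adj z w) :
    ∃ l, IsLeaf G l ∧ z ≠ l ∧ nxt G z l = w ∧ lf u v (pathVec G z l) = 0 := by
  obtain ⟨l, h1, h2, h5, h4⟩ := extend_leaf hG
    (fun i j => u ≠ i ∧ (u ≠ j → lf u v (pathVec G i j) = 0)) (by
    rintro i j hij ⟨hui, h⟩ hj
    by_cases huj : u = j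
    · subst huj
      by_cases hvi : v = nxt G u i
      · obtain ⟨c, hc, h1, -⟩ := ex_nbr2 (h3 u hj) (nxt G u i) (nxt G u i)
        refine ⟨c, hc, h1, hui, fun _ => ?_⟩
        rw [pv_extend hG hij hc h1, map_add, lf_single, pv_comm hG, lf_end hG hui, if_pos hvi,
          if_neg]
        · norm_num
        · rintro rfl; exact h1 hvi
      · refine ⟨v, hv, hvi, hui, fun _ => ?_⟩
        rw [pv_extend hG hij hv hvi, map_add, lf_single, pv_comm hG, lf_end hG hui, if_neg hvi,
          if_pos rfl]
        norm_num
    · obtain ⟨c, hc, h1, -⟩ := ex_nbr2 (h3 j hj) (nxt G j i) (nxt G j i)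
      refine ⟨c, hc, h1, hui, fun huc => ?_⟩
      rw [pv_extend hG hij hc h1, map_add, h huj, lf_single' huj huc, add_zero])
    hw.ne ⟨hz, fun huw => by rw [pv_adj hG hw, lf_single' hz huw]⟩
  refine ⟨l, h1, h2, by rw [h4, nxt_of_adj hG hw], h5.2 ?_⟩
  rintro rfl
  exact hu h1

lemma three_zero (hG : G.IsTree) (f l : (Sym2 V → ℝ) →ₗ[ℝ] ℝ)
    (hf : ∀ i j, i ≠ j → IsLeaf G i → IsLeaf G j → l (pathVec G i j) = 0 → f (pathVec G i j) = 0)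
    {z a b c : V} (ha : IsLeaf G a) (hb : IsLeaf G b) (hc : IsLeaf G c)
    (hza : z ≠ a) (hzb : z ≠ b) (hzc : z ≠ c)
    (hab : nxt G z a ≠ nxt G z b) (hac : nxt G z a ≠ nxt G z c) (hbc : nxt G z b ≠ nxt G z c)
    (la : l (pathVec G z a) = 0) (lb : l (pathVec G z b) = 0) (lc : l (pathVec G z c) = 0) :
    f (pathVec G z a) = 0 := by
  have key : ∀ x y, IsLeaf G x → IsLeaf G y → z ≠ x → z ≠ y → nxt G z x ≠ nxt G z y →
      l (pathVec G z x) = 0 → l (pathVec G z y) = 0 →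
      f (pathVec G z x) + f (pathVec G z y) = 0 := by
    intro x y hx hy hzx hzy hxy lx ly
    have h := pv_K2 hG hzx hzy hxy
    rw [pv_comm hG x z] at h
    rw [← map_add, ← h]
    apply hf x y _ hx hy
    · rw [h, map_add, lx, ly, add_zero]
    · rintro rfl; exact hxy rfl
  have h1 := key a b ha hb hza hzb hab la lb
  have h2 := key a c ha hc hza hzc hac la lc
  have h3 := key b c hb hc hzb hzc hbc lb lc
  linarith

lemma edge_zero (hG : G.IsTree) (f l : (Sym2 V → ℝ) →ₗ[ℝ] ℝ) {z z' m : V} (ha : G.Adj z z')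
    (hz : ∀ m, IsLeaf G m → z ≠ m → l (pathVec G z m) = 0 → f (pathVec G z m) = 0)
    (hz' : ¬ IsLeaf G z' →
      ∀ m, IsLeaf G m → z' ≠ m → l (pathVec G z' m) = 0 → f (pathVec G z' m) = 0)
    (hm : IsLeaf G m) (hzm : z ≠ m) (hn : nxt G z m = z') (hlm : l (pathVec G z m) = 0)
    (hl : l (Pi.single s(z,z') 1) = 0) : f (Pi.single s(z,z') 1) = 0 := by
  have h1 := pv_first hG hzm hn
  have h2 := hz m hm hzm hlm
  by_cases hlf : IsLeaf G z'
  · obtain rfl := leaf_end hG hzm hn hlf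
    rw [← pv_adj hG ha]
    exact h2
  · have h3 := hz' hlf m hm (by rintro rfl; exact hlf hm) (by
      rw [h1, map_add, hl, zero_add] at hlm; exact hlm)
    rw [h1, map_add, h3, add_zero] at h2
    exact h2

/-- Vectors supported on the edges. -/
def WE (G : SimpleGraph V) : Submodule ℝ (Sym2 V → ℝ) where
  carrier := {x | ∀ e, e ∉ G.edgeSet → x e = 0}
  add_mem' := by
    intro a b ha hb e he
    simp [ha e he, hb e he]
  zero_mem' := by intro e _; rfl
  smul_mem' := by
    intro c x hx e he
    simp [hx e he]

lemma pv_mem_WE (i j : V) : pathVec G i j ∈ WE G := fun e he => pv_notEdge i j e he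

lemma ext_WE (f g : (Sym2 V → ℝ) →ₗ[ℝ] ℝ)
    (h : ∀ e ∈ G.edgeSet, f (Pi.single e 1) = g (Pi.single e 1)) : ∀ x ∈ WE G, f x = g x := by
  intro x hx
  have hxs : x = ∑ e, x e • (Pi.single e (1:ℝ) : Sym2 V → ℝ) := by
    funext e'
    simp [Finset.sum_apply, Pi.single_apply]
  rw [hxs, map_sum, map_sum]
  apply Finset.sum_congr rfl
  intro e _
  rw [map_smul, map_smul]
  by_cases he : e ∈ G.edgeSet
  · rw [h e he]
  · rw [hx e he]; simp

lemma H2_F (hG : G.IsTree) (h3 : ∀ w, ¬ IsLeaf G w → 3 ≤ (G.neighborSet w).ncard)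
    (hnl : ∀ a b, G.Adj a b → IsLeaf G a → ¬ IsLeaf G b)
    (e : Sym2 V) (hed : ∀ a ∈ e, (G.neighborSet a).ncard ≠ 3)
    (f : (Sym2 V → ℝ) →ₗ[ℝ] ℝ)
    (hf : ∀ i j, i ≠ j → IsLeaf G i → IsLeaf G j → pathVec G i j e = 0 → f (pathVec G i j) = 0) :
    ∃ t : ℝ, ∀ x ∈ WE G, f x = t * x e := by
  let l : (Sym2 V → ℝ) →ₗ[ℝ] ℝ := LinearMap.proj e
  have hl : ∀ x, l x = x e := fun x => rfl
  have good : ∀ z, ¬ IsLeaf G z → ∀ m, IsLeaf G m → z ≠ m → l (pathVec G z m) = 0 →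
      f (pathVec G z m) = 0 := by
    intro z hz m hm hzm hlm
    set w := nxt G z m with hw
    have hwe : s(z,w) ≠ e := by
      rintro rfl
      rw [hl, nxt_spec hG hzm, if_pos hw] at hlm
      norm_num at hlm
    have : ∃ a b, G.Adj z a ∧ G.Adj z b ∧ a ≠ w ∧ b ≠ w ∧ a ≠ b ∧ s(z,a) ≠ e ∧ s(z,b) ≠ e := by
      by_cases hze : z ∈ e
      · obtain ⟨q, rfl⟩ := hze
        have h4 : 4 ≤ (G.neighborSet z).ncard := by
          have := h3 z hz
          have := hed z (by simp)
          omega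
        obtain ⟨a, ha, ha1, ha2, -⟩ := ex_nbr3 h4 w q q
        obtain ⟨b, hb, hb1, hb2, hb3⟩ := ex_nbr3 h4 w q a
        refine ⟨a, b, ha, hb, ha1, hb1, hb3.symm, ?_, ?_⟩
        · rwa [Ne, Sym2.congr_right]
        · rwa [Ne, Sym2.congr_right]
      · obtain ⟨a, ha, ha1, -⟩ := ex_nbr2 (h3 z hz) w w
        obtain ⟨b, hb, hb1, hb2⟩ := ex_nbr2 (h3 z hz) w a
        refine ⟨a, b, ha, hb, ha1, hb1, hb2.symm, ?_, ?_⟩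
        · rintro rfl; exact hze (by simp)
        · rintro rfl; exact hze (by simp)
    obtain ⟨a, b, ha, hb, ha1, hb1, hab, hae, hbe⟩ := this
    obtain ⟨p, hp, hzp, hnp, hpe⟩ := leaf_F hG h3 ha e hae
    obtain ⟨q, hq, hzq, hnq, hqe⟩ := leaf_F hG h3 hb e hbe
    exact three_zero hG f l hf hm hp hq hzm hzp hzq (by rw [hnp]; exact ha1.symm)
      (by rw [hnq]; exact hb1.symm) (by rw [hnp, hnq]; exact hab) hlm hpe hqe
  have hz : ∀ e' ∈ G.edgeSet, e' ≠ e → f (Pi.single e' 1) = 0 := by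
    have aux : ∀ a b, G.Adj a b → s(a,b) ≠ e → ¬ IsLeaf G a → f (Pi.single s(a,b) 1) = 0 := by
      intro a b hab he ha
      obtain ⟨m, hm, ham, hn, hme⟩ := leaf_F hG h3 hab e he
      exact edge_zero hG f l hab (good a ha) (good b) hm ham hn hme
        (by rw [hl, Pi.single_apply, if_neg he.symm])
    intro e' he' hne
    induction e' with | _ a b => ?_
    have hab : G.Adj a b := he'
    by_cases ha : IsLeaf G a
    · rw [Sym2.eq_swap] at hne ⊢
      exact aux b a hab.symm hne (hnl a b hab ha)
    · exact aux a b hab hne ha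
  refine ⟨f (Pi.single e 1), ?_⟩
  apply ext_WE f (f (Pi.single e 1) • l)
  intro e' he'
  by_cases h : e' = e
  · subst h
    simp [hl]
  · rw [hz e' he' h]
    simp [hl, Pi.single_apply, Ne.symm h]

lemma H2_G (hG : G.IsTree) (h3 : ∀ w, ¬ IsLeaf G w → 3 ≤ (G.neighborSet w).ncard)
    (hnl : ∀ a b, G.Adj a b → IsLeaf G a → ¬ IsLeaf G b)
    {u v : V} (hu : ¬ IsLeaf G u) (hv : G.Adj u v)
    (f : (Sym2 V → ℝ) →ₗ[ℝ] ℝ)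
    (hf : ∀ i j, i ≠ j → IsLeaf G i → IsLeaf G j → lf u v (pathVec G i j) = 0 →
      f (pathVec G i j) = 0) :
    ∃ t : ℝ, ∀ x ∈ WE G, f x = t * lf u v x := by
  have good : ∀ z, u ≠ z → ¬ IsLeaf G z → ∀ m, IsLeaf G m → z ≠ m →
      lf u v (pathVec G z m) = 0 → f (pathVec G z m) = 0 := by
    intro z huz hz m hm hzm hlm
    obtain ⟨a, ha, ha1, -⟩ := ex_nbr2 (h3 z hz) (nxt G z m) (nxt G z m)
    obtain ⟨b, hb, hb1, hb2⟩ := ex_nbr2 (h3 z hz) (nxt G z m) a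
    obtain ⟨p, hp, hzp, hnp, hpe⟩ := leaf_G hG h3 hu hv huz ha
    obtain ⟨q, hq, hzq, hnq, hqe⟩ := leaf_G hG h3 hu hv huz hb
    exact three_zero hG f (lf u v) hf hm hp hq hzm hzp hzq (by rw [hnp]; exact ha1.symm)
      (by rw [hnq]; exact hb1.symm) (by rw [hnp, hnq]; exact hb2.symm) hlm hpe hqe
  have aux : ∀ a b, G.Adj a b → u ≠ a → u ≠ b → ¬ IsLeaf G a → f (Pi.single s(a,b) 1) = 0 := by
    intro a b hab hua hub ha
    obtain ⟨m, hm, ham, hn, hme⟩ := leaf_G hG h3 hu hv hua hab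
    exact edge_zero hG f (lf u v) hab (good a hua ha) (good b hub) hm ham hn hme
      (lf_single' hua hub v)
  -- branch at u
  have br : ∀ w, G.Adj u w → ∃ m, IsLeaf G m ∧ u ≠ m ∧ nxt G u m = w ∧
      f (pathVec G u m) = f (Pi.single s(u,w) 1) := by
    intro w hw
    obtain ⟨m, hm, hum, hn⟩ := leaf_any hG h3 hw
    refine ⟨m, hm, hum, hn, ?_⟩
    have h1 := pv_first hG hum hn
    rw [h1, map_add]
    by_cases hwm : w = m
    · subst hwm
      rw [pv_self hG, map_zero, add_zero]
    · have hwl : ¬ IsLeaf G w := fun h => hwm (leaf_end hG hum hn h)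
      have h2 : lf u v (pathVec G w m) = 0 := by
        have h4 := congrArg (lf u v) h1
        rw [map_add, lf_single, lf_end hG hum, hn] at h4
        linarith
      rw [good w hw.ne hwl m hm hwm h2, add_zero]
  obtain ⟨m, hm, hum, hn, hfm⟩ := br v hv
  have hw : ∀ w, G.Adj u w → w ≠ v → f (Pi.single s(u,w) 1) = - f (Pi.single s(u,v) 1) := by
    intro w hw hwv
    obtain ⟨q, hq, huq, hnq, hfq⟩ := br w hw
    have h1 := pv_K2 hG hum huq (by rw [hn, hnq]; exact hwv.symm)
    rw [pv_comm hG m u] at h1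
    have h2 := hf m q (by rintro rfl; exact hwv (hnq.symm.trans hn)) hm hq (by
      rw [h1, map_add, lf_end hG hum, lf_end hG huq, hn, hnq, if_pos rfl, if_neg hwv.symm]
      norm_num)
    rw [h1, map_add, hfm, hfq] at h2
    linarith
  refine ⟨- f (Pi.single s(u,v) 1), ?_⟩
  apply ext_WE f ((- f (Pi.single s(u,v) 1)) • lf u v)
  have atu : ∀ w, G.Adj u w → f (Pi.single s(u,w) 1) =
      ((- f (Pi.single s(u,v) 1)) • lf u v) (Pi.single s(u,w) 1) := by
    intro w hw'
    rw [LinearMap.smul_apply, lf_single, smul_eq_mul]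
    by_cases hwv : w = v
    · subst hwv; simp; ring
    · rw [hw w hw' hwv, if_neg (Ne.symm hwv)]; ring
  intro e he
  induction e with | _ a b => ?_
  have hab : G.Adj a b := he
  by_cases hua : u = a
  · subst hua; exact atu b hab
  by_cases hub : u = b
  · subst hub; rw [Sym2.eq_swap]; exact atu a hab.symm
  rw [LinearMap.smul_apply, lf_single' hua hub, smul_zero]
  by_cases ha : IsLeaf G a
  · rw [Sym2.eq_swap]
    exact aux b a hab.symm hub hua (hnl a b hab ha)
  · exact aux a b hab hua hub ha

end Comb
section Final
variable [Fintype V] {G : SimpleGraph V}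

lemma local_choice (y : V → ℝ) (hy : ∀ w, 0 ≤ y w) (a : V) (ha : 0 < y a)
    (h : ∀ v, 0 ≤ ∑ w, y w - 2 * y v) :
    ∃ c, c ≠ a ∧ 0 < y c ∧ ∀ v, ∑ w, y w - 2 * y v = 0 → v = a ∨ v = c := by
  have hsum : y a ≤ ∑ w, y w := Finset.single_le_sum (fun w _ => hy w) (Finset.mem_univ a)
  by_cases hv : ∃ v, v ≠ a ∧ ∑ w, y w - 2 * y v = 0
  · obtain ⟨v, hva, hvt⟩ := hv
    refine ⟨v, hva, by linarith, ?_⟩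
    intro v' hv'
    by_contra hn
    push Not at hn
    have h1 : ∑ w ∈ ({a, v, v'} : Finset V), y w ≤ ∑ w, y w :=
      Finset.sum_le_sum_of_subset_of_nonneg (Finset.subset_univ _) (fun w _ _ => hy w)
    rw [Finset.sum_insert (by simp [hva.symm, hn.1.symm]),
      Finset.sum_insert (by simp [hn.2.symm]), Finset.sum_singleton] at h1
    linarith
  · push Not at hv
    have h1 : 0 < ∑ w ∈ Finset.univ.erase a, y w := by
      have := Finset.add_sum_erase Finset.univ y (Finset.mem_univ a)
      have := h a
      linarith
    obtain ⟨c, hc, hc0⟩ := Finset.exists_lt_of_sum_lt (f := fun _ => (0:ℝ)) (g := y)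
      (s := Finset.univ.erase a) (by simpa using h1)
    refine ⟨c, Finset.ne_of_mem_erase hc, hc0, ?_⟩
    intro v hvt
    left
    by_contra hne
    exact hv v hne hvt

lemma path_step (hG : G.IsTree) (x : Sym2 V → ℝ) (hx : x ∈ WE G) (hx0 : ∀ e, 0 ≤ x e)
    (hl : ∀ u v, ¬ IsLeaf G u → G.Adj u v → 0 ≤ lf u v x) (hne : x ≠ 0) :
    ∃ i j, i ≠ j ∧ IsLeaf G i ∧ IsLeaf G j ∧ (∀ e, x e = 0 → pathVec G i j e = 0) ∧
      ∀ u v, ¬ IsLeaf G u → G.Adj u v → lf u v x = 0 → lf u v (pathVec G i j) = 0 := by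
  set Good : V → V → Prop := fun i j => (∀ e, x e = 0 → pathVec G i j e = 0) ∧
    ∀ u v, ¬ IsLeaf G u → G.Adj u v → u ≠ i → u ≠ j → lf u v x = 0 →
      lf u v (pathVec G i j) = 0 with hGood
  have hsymm : ∀ i j, Good i j → Good j i := by
    rintro i j ⟨h1, h2⟩
    refine ⟨fun e he => by rw [pv_comm hG]; exact h1 e he, fun u v hu hv hj hi ht => ?_⟩
    rw [pv_comm hG]
    exact h2 u v hu hv hi hj ht
  have hstep : ∀ i j, i ≠ j → Good i j → ¬ IsLeaf G j →
      ∃ c, G.Adj j c ∧ c ≠ nxt G j i ∧ Good i c := by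
    rintro i j hij ⟨h1, h2⟩ hj
    have ha : 0 < x s(j, nxt G j i) := by
      apply lt_of_le_of_ne (hx0 _)
      intro h
      have := h1 _ h.symm
      rw [pv_comm hG, nxt_spec hG hij.symm, if_pos rfl] at this
      norm_num at this
    have hall : ∀ v, 0 ≤ ∑ w, x s(j,w) - 2 * x s(j,v) := by
      intro v
      by_cases hv : G.Adj j v
      · rw [← lf_apply]; exact hl j v hj hv
      · rw [hx s(j,v) (by simpa using hv)]
        have := Finset.sum_nonneg (s := Finset.univ) (f := fun w => x s(j,w)) (fun w _ => hx0 _)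
        simpa using this
    obtain ⟨c, hca, hc0, hct⟩ := local_choice (fun w => x s(j,w)) (fun w => hx0 _) _ ha hall
    have hjc : G.Adj j c := by
      by_contra h
      rw [hx s(j,c) (by simpa using h)] at hc0
      exact lt_irrefl _ hc0
    refine ⟨c, hjc, hca, ?_, ?_⟩
    · intro e he
      rw [pv_extend hG hij hjc hca, Pi.add_apply, h1 e he, Pi.single_apply, if_neg, add_zero]
      rintro rfl
      exact hc0.ne' he
    · intro u v hu hv hui huc ht
      rw [pv_extend hG hij hjc hca, map_add]
      by_cases huj : u = j
      · subst huj
        rw [lf_single, pv_comm hG, lf_end hG hui]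
        rw [lf_apply] at ht
        rcases hct v ht with h | h
        · rw [if_pos h, if_neg]
          · norm_num
          · rintro rfl; exact hca h
        · rw [if_pos h, if_neg]
          · norm_num
          · rintro h'; exact hca (h.symm.trans h')
      · rw [h2 u v hu hv hui huj ht, lf_single' huj huc, add_zero]
  obtain ⟨e, he⟩ : ∃ e, x e ≠ 0 := by
    by_contra h
    push Not at h
    exact hne (funext h)
  have hee : e ∈ G.edgeSet := by
    by_contra h
    exact he (hx e h)
  induction e with | _ a b => ?_
  have hab : G.Adj a b := hee
  have hg : Good a b := by
    refine ⟨?_, ?_⟩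
    · intro e' he'
      rw [pv_adj hG hab, Pi.single_apply, if_neg]
      rintro rfl
      exact he he'
    · intro u v _ _ hua hub _
      rw [pv_adj hG hab, lf_single' hua hub]
  obtain ⟨l, hl1, hl2, hl3, -⟩ := extend_leaf hG Good hstep hab.ne hg
  obtain ⟨m, hm1, hm2, hm3, -⟩ := extend_leaf hG Good hstep hl2.symm (hsymm _ _ hl3)
  refine ⟨l, m, hm2, hl1, hm1, hm3.1, ?_⟩
  intro u v hu hv ht
  exact hm3.2 u v hu hv (by rintro rfl; exact hu hl1) (by rintro rfl; exact hu hm1) ht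

/-- index type of the pairs (internal vertex, neighbour) -/
abbrev PairIdx (G : SimpleGraph V) := {q : V × V // ¬ IsLeaf G q.1 ∧ G.Adj q.1 q.2}

/-- index type of the edges without endpoint of degree 3 -/
abbrev EdgeIdx (G : SimpleGraph V) :=
  {e : Sym2 V // e ∈ G.edgeSet ∧ ∀ a ∈ e, (G.neighborSet a).ncard ≠ 3}

/-- all constraints -/
def mfun (G : SimpleGraph V) : Sym2 V ⊕ PairIdx G → (Sym2 V → ℝ) →ₗ[ℝ] ℝ :=
  Sum.elim (fun e => LinearMap.proj e) (fun q => lf q.1.1 q.1.2)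

/-- facet constraints -/
def lfun (G : SimpleGraph V) : EdgeIdx G ⊕ PairIdx G → (Sym2 V → ℝ) →ₗ[ℝ] ℝ :=
  Sum.elim (fun e => LinearMap.proj e.1) (fun q => lf q.1.1 q.1.2)

lemma pv_mem_P {i j : V} (hij : i ≠ j) (hi : IsLeaf G i) (hj : IsLeaf G j) :
    pathVec G i j ∈ pathPolytope G :=
  subset_convexHull ℝ _ ⟨i, j, hij, hi, hj, rfl⟩

lemma P_sub {C : Set (Sym2 V → ℝ)} (hC : Convex ℝ C)
    (h : ∀ i j, i ≠ j → IsLeaf G i → IsLeaf G j → pathVec G i j ∈ C) : pathPolytope G ⊆ C := by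
  apply convexHull_min _ hC
  rintro x ⟨i, j, hij, hi, hj, rfl⟩
  exact h i j hij hi hj

lemma P_sub_WE : pathPolytope G ⊆ WE G :=
  P_sub (WE G).convex (fun i j _ _ _ => pv_mem_WE i j)

lemma mfun_pv_nonneg (hG : G.IsTree) {i j : V} (hi : IsLeaf G i) (hj : IsLeaf G j) (k) :
    0 ≤ mfun G k (pathVec G i j) := by
  rcases k with e | ⟨⟨u, v⟩, hu, hv⟩
  · exact pv_nonneg i j e
  · exact lf_nonneg hG (by rintro rfl; exact hu hi) (by rintro rfl; exact hu hj) v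

lemma mfun_P_nonneg (hG : G.IsTree) (k) : ∀ x ∈ pathPolytope G, 0 ≤ mfun G k x :=
  P_sub (C := {x | 0 ≤ mfun G k x}) (convex_halfSpace_ge (mfun G k).isLinear 0)
    (fun _ _ _ hi hj => mfun_pv_nonneg hG hi hj k)

lemma lfun_P_nonneg (hG : G.IsTree) (k) : ∀ x ∈ pathPolytope G, 0 ≤ lfun G k x := by
  rcases k with e | q
  · exact mfun_P_nonneg hG (Sum.inl e.1)
  · exact mfun_P_nonneg hG (Sum.inr q)

lemma H1 (hG : G.IsTree) (h3 : ∀ w, ¬ IsLeaf G w → 3 ≤ (G.neighborSet w).ncard)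
    (h1 : ∀ w, IsLeaf G w → (G.neighborSet w).ncard = 1)
    (c : (Sym2 V → ℝ) →ₗ[ℝ] ℝ) (hc : ∀ x ∈ pathPolytope G, 0 ≤ c x) :
    (∀ x ∈ pathPolytope G, c x = 0) ∨
      ∃ i, ∀ x ∈ pathPolytope G, c x = 0 → lfun G i x = 0 := by
  by_contra hcon
  push Not at hcon
  obtain ⟨⟨x1, hx1, hcx1⟩, hcon⟩ := hcon
  choose y hyP hyc hyl using hcon
  have hcone : ∀ x ∈ WE G, (∀ j, 0 ≤ mfun G j x) → 0 ≤ c x := by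
    apply cone_nonneg
    intro x hx hm hne
    obtain ⟨i, j, hij, hi, hj, he, ht⟩ := path_step hG x hx (fun e => hm (Sum.inl e))
      (fun u v hu hv => hm (Sum.inr ⟨(u,v), hu, hv⟩)) hne
    refine ⟨pathVec G i j, pv_mem_WE i j, hc _ (pv_mem_P hij hi hj), mfun_pv_nonneg hG hi hj, ?_, ?_⟩
    · refine ⟨Sum.inl s(i, nxt G i j), ?_⟩
      show 0 < pathVec G i j s(i, nxt G i j)
      rw [nxt_spec hG hij, if_pos rfl]; norm_num
    · rintro (e | ⟨⟨u, v⟩, hu, hv⟩) h0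
      · exact he e h0
      · exact ht u v hu hv h0
  have hxW : ∑ i, y i ∈ WE G := Submodule.sum_mem _ (fun i _ => P_sub_WE (hyP i))
  have hpos' : ∀ i, 0 < lfun G i (∑ i, y i) := by
    intro i
    rw [map_sum]
    apply Finset.sum_pos' (fun k _ => lfun_P_nonneg hG i _ (hyP k))
    exact ⟨i, Finset.mem_univ _, lt_of_le_of_ne (lfun_P_nonneg hG i _ (hyP i)) (hyl i).symm⟩
  have hz := interior_zero (mfun G) c (WE G) hcone (∑ i, y i) hxW
    (by rw [map_sum]; exact Finset.sum_eq_zero (fun i _ => hyc i)) (by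
      rintro (e | q)
      · by_cases he : e ∈ G.edgeSet
        · left
          show 0 < (∑ i, y i) e
          by_cases hd : ∀ a ∈ e, (G.neighborSet a).ncard ≠ 3
          · exact hpos' (Sum.inl ⟨e, he, hd⟩)
          · push Not at hd
            obtain ⟨a, ⟨b, rfl⟩, had⟩ := hd
            have hab : G.Adj a b := he
            have hal : ¬ IsLeaf G a := fun h => by
              have := h1 a h
              omega
            obtain ⟨p, hp, hpb, -⟩ := ex_nbr2 (h3 a hal) b b
            obtain ⟨q, hq, hqb, hqp⟩ := ex_nbr2 (h3 a hal) b p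
            have e1 : 0 < lf a p (∑ i, y i) := hpos' (Sum.inr ⟨(a,p), hal, hp⟩)
            have e2 : 0 < lf a q (∑ i, y i) := hpos' (Sum.inr ⟨(a,q), hal, hq⟩)
            generalize ∑ i, y i = x at *
            rw [lf_apply] at e1 e2
            have hN : G.neighborSet a = (({b, p, q} : Finset V) : Set V) := by
              symm
              apply Set.eq_of_subset_of_ncard_le
              · intro w hw
                simp at hw
                rcases hw with rfl | rfl | rfl
                · exact hab
                · exact hp
                · exact hq
              · rw [had, Set.ncard_coe_finset, Finset.card_insert_of_notMem (by simp [hpb.symm, hqb.symm]),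
                  Finset.card_pair hqp.symm]
              · exact Set.toFinite _
            have hs : ∑ w, x s(a,w) = x s(a,b) + (x s(a,p) + x s(a,q)) := by
              rw [← Finset.sum_subset (Finset.subset_univ ({b, p, q} : Finset V))]
              · rw [Finset.sum_insert (by simp [hpb.symm, hqb.symm]), Finset.sum_pair hqp.symm]
              · intro w _ hw
                apply hxW
                intro hw'
                apply hw
                have : w ∈ G.neighborSet a := hw'
                rw [hN] at this
                exact this
            rw [hs] at e1 e2
            linarith
        · right
          intro d hd
          exact hd e he
      · left
        exact hpos' (Sum.inr q))
  exact hcx1 (hz x1 (P_sub_WE hx1))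

lemma H2 (hG : G.IsTree) (h3 : ∀ w, ¬ IsLeaf G w → 3 ≤ (G.neighborSet w).ncard)
    (hnl : ∀ a b, G.Adj a b → IsLeaf G a → ¬ IsLeaf G b) (k : EdgeIdx G ⊕ PairIdx G)
    (f : (Sym2 V → ℝ) →ₗ[ℝ] ℝ) (hf : ∀ x ∈ pathPolytope G, lfun G k x = 0 → f x = 0) :
    ∃ t : ℝ, ∀ x ∈ WE G, f x = t * lfun G k x := by
  rcases k with ⟨e, he, hd⟩ | ⟨⟨u, v⟩, hu, hv⟩
  · exact H2_F hG h3 hnl e hd f (fun i j hij hi hj h => hf _ (pv_mem_P hij hi hj) h)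
  · exact H2_G hG h3 hnl hu hv f (fun i j hij hi hj h => hf _ (pv_mem_P hij hi hj) h)

lemma H3 (hG : G.IsTree) (h3 : ∀ w, ¬ IsLeaf G w → 3 ≤ (G.neighborSet w).ncard)
    (hnl : ∀ a b, G.Adj a b → IsLeaf G a → ¬ IsLeaf G b) (k : EdgeIdx G ⊕ PairIdx G) :
    ∃ x ∈ pathPolytope G, lfun G k x ≠ 0 := by
  have key : ∀ z a b, a ≠ b → G.Adj z a → G.Adj z b → ∃ x ∈ pathPolytope G,
      x s(z,a) = 1 ∧ ∀ v, v ≠ a → v ≠ b → lf z v x = 2 := by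
    intro z a b hab ha hb
    obtain ⟨p, hp, hzp, hnp⟩ := leaf_any hG h3 ha
    obtain ⟨q, hq, hzq, hnq⟩ := leaf_any hG h3 hb
    have h1 := pv_K2 hG hzp hzq (by rw [hnp, hnq]; exact hab)
    rw [pv_comm hG p z] at h1
    refine ⟨pathVec G p q, pv_mem_P (by rintro rfl; exact hab (hnp.symm.trans hnq)) hp hq, ?_, ?_⟩
    · rw [h1, Pi.add_apply, nxt_spec hG hzp, nxt_spec hG hzq, hnp, hnq, if_pos rfl, if_neg hab]
      norm_num
    · intro v hva hvb
      rw [h1, map_add, lf_end hG hzp, lf_end hG hzq, hnp, hnq, if_neg hva, if_neg hvb]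
      norm_num
  rcases k with ⟨e, he, hd⟩ | ⟨⟨u, v⟩, hu, hv⟩
  · have aux : ∀ a b, G.Adj a b → ¬ IsLeaf G a → ∃ x ∈ pathPolytope G, x s(a,b) ≠ 0 := by
      intro a b hab ha
      obtain ⟨c, hc, hcb, -⟩ := ex_nbr2 (h3 a ha) b b
      obtain ⟨x, hx, hx1, -⟩ := key a b c hcb.symm hab hc
      exact ⟨x, hx, by rw [hx1]; norm_num⟩
    show ∃ x ∈ pathPolytope G, x e ≠ 0
    clear hd
    induction e with | _ a b => ?_
    have hab : G.Adj a b := he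
    by_cases ha : IsLeaf G a
    · rw [Sym2.eq_swap]; exact aux b a hab.symm (hnl a b hab ha)
    · exact aux a b hab ha
  · obtain ⟨a, ha, ha1, -⟩ := ex_nbr2 (h3 u hu) v v
    obtain ⟨b, hb, hb1, hb2⟩ := ex_nbr2 (h3 u hu) v a
    obtain ⟨x, hx, -, hx2⟩ := key u a b hb2.symm ha hb
    refine ⟨x, hx, ?_⟩
    show lf u v x ≠ 0
    rw [hx2 v ha1.symm hb1.symm]; norm_num

lemma single_mem_WE {e : Sym2 V} (he : e ∈ G.edgeSet) : (Pi.single e 1 : Sym2 V → ℝ) ∈ WE G := by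
  intro e' he'
  rw [Pi.single_apply, if_neg]
  rintro rfl
  exact he' he

lemma H4 (hG : G.IsTree) (h3 : ∀ w, ¬ IsLeaf G w → 3 ≤ (G.neighborSet w).ncard)
    (hnl : ∀ a b, G.Adj a b → IsLeaf G a → ¬ IsLeaf G b) (k : EdgeIdx G ⊕ PairIdx G) :
    G.edgeSet.ncard ≤ Module.finrank ℝ (Submodule.span ℝ (pathPolytope G)) := by
  have hmem : ∀ e : G.edgeSet, (Pi.single e.1 1 : Sym2 V → ℝ) ∈
      Submodule.span ℝ (pathPolytope G) := by
    rintro ⟨e, he⟩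
    by_contra hn
    obtain ⟨f, hf, hfk⟩ := Submodule.exists_le_ker_of_notMem hn
    have hf0 : ∀ x ∈ pathPolytope G, f x = 0 := fun x hx => hfk (Submodule.subset_span hx)
    obtain ⟨t, ht⟩ := H2 hG h3 hnl k f (fun x hx _ => hf0 x hx)
    obtain ⟨x, hx, hxl⟩ := H3 hG h3 hnl k
    have h1 := ht x (P_sub_WE hx)
    rw [hf0 x hx] at h1
    have ht0 : t = 0 := by
      rcases mul_eq_zero.1 h1.symm with h | h
      · exact h
      · exact (hxl h).elim
    apply hf
    rw [ht _ (single_mem_WE he), ht0, zero_mul]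
  have hli : LinearIndependent ℝ (fun e : G.edgeSet => (Pi.single e.1 1 : Sym2 V → ℝ)) := by
    have := (Pi.basisFun ℝ (Sym2 V)).linearIndependent.comp (fun e : G.edgeSet => e.1)
      Subtype.val_injective
    convert this using 2 with e
    simp
  have hli2 : LinearIndependent ℝ (fun e : G.edgeSet =>
      (⟨Pi.single e.1 1, hmem e⟩ : Submodule.span ℝ (pathPolytope G))) := by
    apply LinearIndependent.of_comp (Submodule.subtype _)
    exact hli
  have := hli2.fintype_card_le_finrank
  rwa [← Nat.card_eq_fintype_card, Nat.card_coe_set_eq] at this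

lemma facet_inj (hG : G.IsTree) (h3 : ∀ w, ¬ IsLeaf G w → 3 ≤ (G.neighborSet w).ncard)
    (hnl : ∀ a b, G.Adj a b → IsLeaf G a → ¬ IsLeaf G b) :
    Function.Injective (fun i => {x ∈ pathPolytope G | lfun G i x = 0}) := by
  have prop : ∀ i j, {x ∈ pathPolytope G | lfun G i x = 0} = {x ∈ pathPolytope G | lfun G j x = 0} →
      ∃ t : ℝ, ∀ x ∈ WE G, lfun G j x = t * lfun G i x := by
    intro i j h
    apply H2 hG h3 hnl i
    intro x hx hxi
    have : x ∈ {x ∈ pathPolytope G | lfun G j x = 0} := by rw [← h]; exact ⟨hx, hxi⟩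
    exact this.2
  have pm : ∀ u v w : V, lf u v (Pi.single s(u,w) 1) ≠ 0 := by
    intro u v w
    rw [lf_single]
    split_ifs <;> norm_num
  have mixed : ∀ (e : EdgeIdx G) (q : PairIdx G), {x ∈ pathPolytope G | lfun G (Sum.inl e) x = 0}
      ≠ {x ∈ pathPolytope G | lfun G (Sum.inr q) x = 0} := by
    rintro ⟨e, he, hd⟩ ⟨⟨u, v⟩, hu, hv⟩ h
    obtain ⟨t, ht⟩ := prop _ _ h
    have ht : ∀ x ∈ WE G, lf u v x = t * x e := ht
    have hu : ¬ IsLeaf G u := hu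
    obtain ⟨a, ha, hae⟩ : ∃ a, G.Adj u a ∧ s(u,a) ≠ e := by
      obtain ⟨a, ha, -⟩ := ex_nbr2 (h3 u hu) u u
      by_cases hae : s(u,a) = e
      · obtain ⟨b, hb, hba, -⟩ := ex_nbr2 (h3 u hu) a a
        refine ⟨b, hb, ?_⟩
        rw [← hae, Ne, Sym2.congr_right]
        exact hba
      · exact ⟨a, ha, hae⟩
    have := ht _ (single_mem_WE (e := s(u,a)) ha)
    rw [Pi.single_apply, if_neg hae.symm, mul_zero] at this
    exact pm _ _ _ this
  rintro (⟨e, he, hd⟩ | ⟨⟨u, v⟩, hu, hv⟩) (⟨e', he', hd'⟩ | ⟨⟨u', v'⟩, hu', hv'⟩) h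
  · obtain ⟨t, ht⟩ := prop _ _ h
    have ht : ∀ x ∈ WE G, x e' = t * x e := ht
    have := ht _ (single_mem_WE he')
    by_cases hee : e = e'
    · subst hee; rfl
    · rw [Pi.single_apply, Pi.single_apply, if_pos rfl, if_neg hee] at this
      norm_num at this
  · exact (mixed _ _ h).elim
  · exact (mixed _ _ h.symm).elim
  · obtain ⟨t, ht⟩ := prop _ _ h
    have ht : ∀ x ∈ WE G, lf u' v' x = t * lf u v x := ht
    have hu : ¬ IsLeaf G u := hu
    have hu' : ¬ IsLeaf G u' := hu'
    have huu : u = u' := by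
      by_contra huu
      obtain ⟨w, hw, hwu, -⟩ := ex_nbr2 (h3 u' hu') u u
      have := ht _ (single_mem_WE (e := s(u',w)) hw)
      rw [lf_single' huu hwu.symm, mul_zero] at this
      exact pm _ _ _ this
    subst huu
    have hvv : v = v' := by
      by_contra hvv
      obtain ⟨w, hw, hwv, hwv'⟩ := ex_nbr2 (h3 u hu) v v'
      have e1 := ht _ (single_mem_WE (e := s(u,w)) hw)
      have e2 := ht _ (single_mem_WE (e := s(u,v)) hv)
      rw [lf_single, lf_single, if_neg hwv.symm, if_neg hwv'.symm] at e1
      rw [lf_single, lf_single, if_pos rfl, if_neg (Ne.symm hvv)] at e2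
      linarith
    subst hvv
    rfl

lemma leafsum_two (hG : G.IsTree) : ∃ L : (Sym2 V → ℝ) →ₗ[ℝ] ℝ, ∀ x ∈ pathPolytope G, L x = 2 := by
  refine ⟨∑ v ∈ Finset.univ.filter (fun v => IsLeaf G v), ∑ w : V, LinearMap.proj s(v,w), ?_⟩
  set L : (Sym2 V → ℝ) →ₗ[ℝ] ℝ :=
    ∑ v ∈ Finset.univ.filter (fun v => IsLeaf G v), ∑ w : V, LinearMap.proj s(v,w) with hL
  apply P_sub (C := {x | L x = 2}) (convex_hyperplane L.isLinear 2)
  intro i j hij hi hj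
  show L (pathVec G i j) = 2
  have : L (pathVec G i j) = ∑ v ∈ Finset.univ.filter (fun v => IsLeaf G v),
      ∑ w, pathVec G i j s(v,w) := by
    simp [hL]
  rw [this, Finset.sum_congr rfl (fun v hv => leaf_sum hG hij (by simpa using hv)),
    Finset.sum_add_distrib, Finset.sum_ite_eq', Finset.sum_ite_eq']
  simp [hi, hj]
  norm_num

end Final

/-- For a tree with at least 3 edges and no internal vertex of degree 2,
the number of facets of the path polytope is `(|E| − e₃) + d`, where `e₃` is the number of
edges with an endpoint of degree 3 and `d` is the sum of the degrees of the internal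
vertices. -/
theorem pathPolytope_facet_count [Fintype V] (G : SimpleGraph V)
    (hG : G.IsTree) (hE : 3 ≤ G.edgeSet.ncard)
    (hdeg2 : ∀ w, ¬ IsLeaf G w → (G.neighborSet w).ncard ≠ 2) :
    Set.ncard {F : Set (Sym2 V → ℝ) | IsFacetOf (pathPolytope G) F}
      = (G.edgeSet.ncard
          - Set.ncard {e ∈ G.edgeSet | ∃ a ∈ e, (G.neighborSet a).ncard = 3})
        + ∑ᶠ u ∈ {w : V | ¬ IsLeaf G w}, (G.neighborSet u).ncard := by

  have hcardV : 4 ≤ Nat.card V := by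
    have h1 := hG.card_edgeFinset
    rw [← SimpleGraph.coe_edgeFinset, Set.ncard_coe_finset] at hE
    rw [Nat.card_eq_fintype_card]
    omega
  have hnontriv : Nontrivial V := by
    rw [← Finite.one_lt_card_iff_nontrivial]; omega
  have h1 : ∀ w, IsLeaf G w → (G.neighborSet w).ncard = 1 := by
    rintro w ⟨a, ha, hu⟩
    rw [Set.ncard_eq_one]
    refine ⟨a, ?_⟩
    ext b
    exact ⟨fun hb => hu b hb, by rintro rfl; exact ha⟩
  have h3 : ∀ w, ¬ IsLeaf G w → 3 ≤ (G.neighborSet w).ncard := by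
    intro w hw
    have e2 := hdeg2 w hw
    have e1 : (G.neighborSet w).ncard ≠ 1 := by
      intro h
      rw [Set.ncard_eq_one] at h
      obtain ⟨a, ha⟩ := h
      apply hw
      refine ⟨a, ?_, ?_⟩
      · show a ∈ G.neighborSet w
        rw [ha]; rfl
      · intro b hb
        have : b ∈ G.neighborSet w := hb
        rw [ha] at this
        exact this
    have e0 : (G.neighborSet w).ncard ≠ 0 := by
      obtain ⟨j, hj⟩ := exists_ne w
      rw [Ne, Set.ncard_eq_zero (Set.toFinite _)]
      intro h
      have : nxt G w j ∈ G.neighborSet w := nxt_adj hG hj.symm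
      rw [h] at this
      exact this
    omega
  have hnl : ∀ a b, G.Adj a b → IsLeaf G a → ¬ IsLeaf G b := by
    intro a b hab ha hb
    obtain ⟨c, -, hc⟩ := Set.exists_mem_notMem_of_ncard_lt_ncard (s := {a, b})
      (t := (Set.univ : Set V)) (by
        rw [Set.ncard_univ]
        exact lt_of_le_of_lt (Set.ncard_insert_le _ _) (by rw [Set.ncard_singleton]; omega))
    simp at hc
    have hac : a ≠ c := fun h => hc.1 h.symm
    have hn : nxt G a c = b := leaf_unique ha (nxt_adj hG hac) hab
    exact hc.2 (leaf_end hG hac hn hb).symm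
  have hk : Nonempty (EdgeIdx G ⊕ PairIdx G) := by
    obtain ⟨a, b, hab⟩ := exists_pair_ne V
    have h := nxt_adj hG hab
    by_cases ha : IsLeaf G a
    · exact ⟨Sum.inr ⟨(_, _), hnl _ _ h ha, h.symm⟩⟩
    · exact ⟨Sum.inr ⟨(_, _), ha, h⟩⟩
  obtain ⟨k⟩ := hk
  obtain ⟨L, hL⟩ := leafsum_two hG
  rw [facets_eq (pathPolytope G) L hL (lfun G) (lfun_P_nonneg hG) (H1 hG h3 h1)
    (fun i f hf => by
      obtain ⟨t, ht⟩ := H2 hG h3 hnl i f hf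
      exact ⟨t, fun x hx => ht x (P_sub_WE hx)⟩)
    (H3 hG h3 hnl) (hE.trans (H4 hG h3 hnl k))]
  rw [← Nat.card_coe_set_eq, Nat.card_range_of_injective (facet_inj hG h3 hnl), Nat.card_sum]
  congr 1
  · rw [← Set.ncard_diff (fun e he => he.1) (Set.toFinite _)]
    rw [← Nat.card_coe_set_eq]
    apply Nat.card_congr
    apply Equiv.subtypeEquivRight
    intro e
    simp only [Set.mem_diff, Set.mem_setOf_eq]
    constructor
    · rintro ⟨h, h'⟩
      exact ⟨h, fun ⟨_, a, ha, had⟩ => h' a ha had⟩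
    · rintro ⟨h, h'⟩
      exact ⟨h, fun a ha had => h' ⟨h, a, ha, had⟩⟩
  · rw [← finsum_set_coe_eq_finsum_mem, finsum_eq_sum_of_fintype]
    have : ∀ u : {w : V | ¬ IsLeaf G w}, (G.neighborSet u.1).ncard = Nat.card (G.neighborSet u.1) :=
      fun u => (Nat.card_coe_set_eq _).symm
    simp_rw [this]
    rw [← Nat.card_sigma]
    apply Nat.card_congr
    exact {
      toFun := fun q => ⟨⟨q.1.1, q.2.1⟩, ⟨q.1.2, q.2.2⟩⟩
      invFun := fun s => ⟨(s.1.1, s.2.1), s.1.2, s.2.2⟩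
      left_inv := fun _ => rfl
      right_inv := fun _ => rfl }
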